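/- Let n ≥ 5 be an integer, p > (n+4)/(n−4), and set K = K₀^{1/(p−1)}. Let s₀ ∈ ℝ and let z₁, z₂, z₃, z₄ : (−∞, s₀] → ℝ be continuously differentiable functions satisfying the system z₁' = (4/(p−1))z₁ + z₂, z₂' = (4/(p−1)+2)z₂ + z₃, z₃' = (4/(p−1)−(n−2))z₃ + z₄, z₄' = |z₁+K|^{p−1}(z₁+K) − K^p + (4/(p−1)−(n−4))z₄ on (−∞, s₀]. If z₁(s₀) < 0, z₂(s₀) > 0, z₃(s₀) < 0 and z₄(s₀) > 0, then for every s ≤ s₀ one has z₁(s) < 0, z₂(s) > 0, z₃(s) < 0 and z₄(s) > 0; moreover there exists a constant δ > 0 such that z₁(s) ≤ −δ·e^{−(n−2−4/(p−1))s} for all s ≤ s₀. In particular z₁(s) → −∞ as s → −∞. -/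

import Mathlib

/-- A solution of `y' = c y - g` with `g ≥ 0`, weighted by `exp (-c s)`, is nonincreasing. -/
theorem mul_exp_le_mul_exp_of_hasDerivAt {y g : ℝ → ℝ} {c m t : ℝ} (hmt : m ≤ t)
    (hy : ∀ s ∈ Set.Icc m t, HasDerivAt y (c * y s - g s) s)
    (hg : ∀ s ∈ Set.Ioo m t, 0 ≤ g s) :
    y t * Real.exp (-c * t) ≤ y m * Real.exp (-c * m) := by
  have hd : ∀ s ∈ Set.Icc m t,
      HasDerivAt (fun s => y s * Real.exp (-c * s)) (-(g s * Real.exp (-c * s))) s := by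
    intro s hs
    have he : HasDerivAt (fun s : ℝ => Real.exp (-c * s)) (Real.exp (-c * s) * (-c * 1)) s :=
      ((hasDerivAt_id s).const_mul (-c)).exp
    refine ((hy s hs).mul he).congr_deriv ?_
    ring
  have hanti : AntitoneOn (fun s => y s * Real.exp (-c * s)) (Set.Icc m t) := by
    refine antitoneOn_of_hasDerivWithinAt_nonpos (convex_Icc m t)
      (f' := fun s => -(g s * Real.exp (-c * s)))
      (fun s hs => (hd s hs).continuousAt.continuousWithinAt)
      (fun s hs => (hd s (interior_subset hs)).hasDerivWithinAt) ?_
    intro s hs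
    rw [interior_Icc] at hs
    have := mul_nonneg (hg s hs) (Real.exp_pos (-c * s)).le
    linarith
  exact hanti (Set.left_mem_Icc.2 hmt) (Set.right_mem_Icc.2 hmt) hmt

/-- Positivity propagates backwards in time for a system `yᵢ' = cᵢ yᵢ - gᵢ` whose forcing terms
are nonnegative as long as all components are positive. -/
theorem pos_backward_of_hasDerivAt {ι : Type*} [Finite ι] {y g : ι → ℝ → ℝ} {c : ι → ℝ} {t : ℝ}
    (hy : ∀ i, ∀ s ≤ t, HasDerivAt (y i) (c i * y i s - g i s) s)
    (hg : ∀ s ≤ t, (∀ i, 0 < y i s) → ∀ i, 0 ≤ g i s)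
    (ht : ∀ i, 0 < y i t) : ∀ s ≤ t, ∀ i, 0 < y i s := by
  by_contra! h
  obtain ⟨a, hat, j, hj⟩ := h
  let S : Set ℝ := ⋃ i, (Set.Icc a t ∩ y i ⁻¹' Set.Iic 0)
  have hcl : IsClosed S := isClosed_iUnion_of_finite fun i =>
    ContinuousOn.preimage_isClosed_of_isClosed
      (fun s hs => (hy i s hs.2).continuousAt.continuousWithinAt) isClosed_Icc isClosed_Iic
  have hne : S.Nonempty := ⟨a, Set.mem_iUnion.2 ⟨j, ⟨le_rfl, hat⟩, hj⟩⟩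
  have hbdd : BddAbove S := ⟨t, fun s hs => by
    obtain ⟨i, hi⟩ := Set.mem_iUnion.1 hs
    exact hi.1.2⟩
  obtain ⟨k, hk, hk0⟩ := Set.mem_iUnion.1 (hcl.csSup_mem hne hbdd)
  have hpos : ∀ s ∈ Set.Ioo (sSup S) t, ∀ i, 0 < y i s := by
    intro s hs i
    by_contra! hi
    exact absurd (le_csSup hbdd (Set.mem_iUnion.2 ⟨i, ⟨hk.1.trans hs.1.le, hs.2.le⟩, hi⟩))
      (not_le.2 hs.1)
  have hle := mul_exp_le_mul_exp_of_hasDerivAt hk.2 (fun s hs => hy k s hs.2)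
    (fun s hs => hg s hs.2.le (hpos s hs) k)
  have h1 := mul_pos (ht k) (Real.exp_pos (-c k * t))
  have h2 := mul_nonpos_of_nonpos_of_nonneg hk0 (Real.exp_pos (-c k * sSup S)).le
  linarith

/-- A positive solution of `y' = c y - g` inherits, backwards in time, an exponential lower bound
on `g` whose rate is smaller than `c`. -/
theorem exists_mul_exp_le_of_hasDerivAt {y g : ℝ → ℝ} {c d B t : ℝ} (hdc : d < c) (hB : 0 < B)
    (hy : ∀ s ≤ t, HasDerivAt y (c * y s - g s) s)
    (hg : ∀ s ≤ t, B * Real.exp (d * s) ≤ g s) (ht : 0 < y t) :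
    ∃ δ : ℝ, 0 < δ ∧ ∀ s ≤ t, δ * Real.exp (d * s) ≤ y s := by
  have hcd : 0 < c - d := sub_pos.2 hdc
  obtain ⟨δ, hδ, hδB, hδt⟩ : ∃ δ : ℝ, 0 < δ ∧ δ * (c - d) ≤ B ∧ δ * Real.exp (d * t) ≤ y t := by
    refine ⟨min (B / (c - d)) (y t / Real.exp (d * t)), by positivity, ?_, ?_⟩
    · exact (le_div_iff₀ hcd).1 (min_le_left _ _)
    · exact (le_div_iff₀ (Real.exp_pos _)).1 (min_le_right _ _)
  refine ⟨δ, hδ, fun m hm => ?_⟩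
  have key := mul_exp_le_mul_exp_of_hasDerivAt (y := fun s => y s - δ * Real.exp (d * s))
    (g := fun s => g s - δ * (c - d) * Real.exp (d * s)) (c := c) hm
    (fun s hs => by
      have he : HasDerivAt (fun s : ℝ => Real.exp (d * s)) (Real.exp (d * s) * (d * 1)) s :=
        ((hasDerivAt_id s).const_mul d).exp
      refine ((hy s hs.2).sub (he.const_mul δ)).congr_deriv ?_
      ring)
    (fun s hs => by
      have h1 := hg s hs.2.le
      have h2 := mul_le_mul_of_nonneg_right hδB (Real.exp_pos (d * s)).le
      linarith)
  have h0 : 0 ≤ (y t - δ * Real.exp (d * t)) * Real.exp (-c * t) :=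
    mul_nonneg (sub_nonneg.2 hδt) (Real.exp_pos _).le
  exact sub_nonneg.1 (nonneg_of_mul_nonneg_left (h0.trans key) (Real.exp_pos _))

/-- The odd power `x ↦ |x| ^ (p - 1) * x` is at most `K ^ p` for `x ≤ K`. -/
theorem abs_rpow_sub_one_mul_self_le {p K x : ℝ} (hp : 1 < p) (hK : 0 < K) (hx : x ≤ K) :
    |x| ^ (p - 1) * x ≤ K ^ p := by
  rcases le_total x 0 with h | h
  · exact (mul_nonpos_of_nonneg_of_nonpos (Real.rpow_nonneg (abs_nonneg x) _) h).trans
      (Real.rpow_nonneg hK.le _)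
  · have hKp : K ^ p = K ^ (p - 1) * K := by
      rw [← Real.rpow_add_one hK.ne']
      ring_nf
    rw [abs_of_nonneg h, hKp]
    exact mul_le_mul (Real.rpow_le_rpow h hx (by linarith)) hx h (Real.rpow_nonneg hK.le _)


/-- for the shifted autonomous system associated with
`Δ²u = |u|^{p−1}u` around the equilibrium `K = K₀^{1/(p−1)}`, if at some time
`s₀` one has the sign pattern `z₁ < 0, z₂ > 0, z₃ < 0, z₄ > 0`, then this sign
pattern persists for all `s ≤ s₀`; moreover there is `δ > 0` with
`z₁(s) ≤ −δ e^{−(n−2−4/(p−1))s}` for all `s ≤ s₀`, so `z₁(s) → −∞` as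
`s → −∞`. -/
theorem statement2 (n : ℕ) (hn : 5 ≤ n) (p : ℝ)
    (hp : ((n : ℝ) + 4) / ((n : ℝ) - 4) < p)
    (K : ℝ)
    (hK : K = ((4 / (p - 1)) * (4 / (p - 1) + 2) * ((n : ℝ) - 2 - 4 / (p - 1))
      * ((n : ℝ) - 4 - 4 / (p - 1))) ^ (1 / (p - 1)))
    (s₀ : ℝ) (z₁ z₂ z₃ z₄ : ℝ → ℝ)
    (h1 : ∀ s ≤ s₀, HasDerivAt z₁ (4 / (p - 1) * z₁ s + z₂ s) s)
    (h2 : ∀ s ≤ s₀, HasDerivAt z₂ ((4 / (p - 1) + 2) * z₂ s + z₃ s) s)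
    (h3 : ∀ s ≤ s₀, HasDerivAt z₃ ((4 / (p - 1) - ((n : ℝ) - 2)) * z₃ s + z₄ s) s)
    (h4 : ∀ s ≤ s₀, HasDerivAt z₄
      (|z₁ s + K| ^ (p - 1) * (z₁ s + K) - K ^ p
        + (4 / (p - 1) - ((n : ℝ) - 4)) * z₄ s) s)
    (hz1 : z₁ s₀ < 0) (hz2 : 0 < z₂ s₀) (hz3 : z₃ s₀ < 0) (hz4 : 0 < z₄ s₀) :
    (∀ s ≤ s₀, z₁ s < 0 ∧ 0 < z₂ s ∧ z₃ s < 0 ∧ 0 < z₄ s) ∧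
    (∃ δ : ℝ, 0 < δ ∧ ∀ s ≤ s₀,
      z₁ s ≤ -δ * Real.exp (-((n : ℝ) - 2 - 4 / (p - 1)) * s)) ∧
    Filter.Tendsto z₁ Filter.atBot Filter.atBot := by
  have hn' : (5 : ℝ) ≤ n := by exact_mod_cast hn
  have hn4 : (0 : ℝ) < n - 4 := by linarith
  rw [div_lt_iff₀ hn4] at hp
  have hp1 : 1 < p := by
    by_contra! h
    have := mul_le_mul_of_nonneg_right h hn4.le
    linarith
  have hp0 : 0 < p - 1 := sub_pos.2 hp1
  have ha4 : 4 / (p - 1) < n - 4 := by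
    rw [div_lt_iff₀ hp0]
    linarith
  have ha : 0 < 4 / (p - 1) := by positivity
  have hK0 : 0 < K := by
    rw [hK]
    have h2 : 0 < (n : ℝ) - 2 - 4 / (p - 1) := by linarith
    have h4 : 0 < (n : ℝ) - 4 - 4 / (p - 1) := by linarith
    positivity
  clear hK
  generalize 4 / (p - 1) = a at *
  have hpos := pos_backward_of_hasDerivAt (t := s₀)
    (y := ![fun s => -z₁ s, z₂, fun s => -z₃ s, z₄])
    (g := ![z₂, fun s => -z₃ s, z₄, fun s => K ^ p - |z₁ s + K| ^ (p - 1) * (z₁ s + K)])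
    (c := ![a, a + 2, a - ((n : ℝ) - 2), a - ((n : ℝ) - 4)])
    (by
      intro i s hs
      fin_cases i
      · exact (h1 s hs).neg.congr_deriv (by simp; ring)
      · exact (h2 s hs).congr_deriv (by simp)
      · exact (h3 s hs).neg.congr_deriv (by simp; ring)
      · exact (h4 s hs).congr_deriv (by simp; ring))
    (by
      intro s _ hall i
      have q1 : 0 < -z₁ s := hall 0
      have q2 : 0 < z₂ s := hall 1
      have q3 : 0 < -z₃ s := hall 2
      have q4 : 0 < z₄ s := hall 3
      fin_cases i
      · exact q2.le
      · exact q3.le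
      · exact q4.le
      · exact sub_nonneg.2 (abs_rpow_sub_one_mul_self_le hp1 hK0 (by linarith)))
    (by
      intro i
      fin_cases i
      · exact neg_pos.2 hz1
      · exact hz2
      · exact neg_pos.2 hz3
      · exact hz4)
  have hsign : ∀ s ≤ s₀, z₁ s < 0 ∧ 0 < z₂ s ∧ z₃ s < 0 ∧ 0 < z₄ s := fun s hs =>
    ⟨neg_pos.1 (hpos s hs 0), hpos s hs 1, neg_pos.1 (hpos s hs 2), hpos s hs 3⟩
  set d : ℝ := -((n : ℝ) - 2 - a) with hd
  have hz3' : ∀ s ≤ s₀, -z₃ s₀ * Real.exp (-d * s₀) * Real.exp (d * s) ≤ -z₃ s := by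
    intro m hm
    have h := mul_exp_le_mul_exp_of_hasDerivAt (y := fun s => -z₃ s) (g := z₄) (c := d) hm
      (fun s hs => (h3 s hs.2).neg.congr_deriv (by rw [hd]; ring))
      (fun s hs => (hsign s hs.2.le).2.2.2.le)
    refine (mul_le_mul_of_nonneg_right h (Real.exp_pos (d * m)).le).trans_eq ?_
    rw [mul_assoc, ← Real.exp_add]
    simp
  obtain ⟨B, hB, hz2'⟩ := exists_mul_exp_le_of_hasDerivAt (g := fun s => -z₃ s) (c := a + 2)
    (by linarith) (mul_pos (neg_pos.2 hz3) (Real.exp_pos _))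
    (fun s hs => (h2 s hs).congr_deriv (by ring)) hz3' hz2
  obtain ⟨δ, hδ, hz1'⟩ := exists_mul_exp_le_of_hasDerivAt (y := fun s => -z₁ s) (c := a)
    (by linarith) hB (fun s hs => (h1 s hs).neg.congr_deriv (by ring)) hz2' (neg_pos.2 hz1)
  have hbound : ∀ s ≤ s₀, z₁ s ≤ -δ * Real.exp (d * s) := fun s hs => by
    have := hz1' s hs
    linarith
  refine ⟨hsign, ⟨δ, hδ, hbound⟩, ?_⟩
  have hlim : Filter.Tendsto (fun s => -δ * Real.exp (d * s)) Filter.atBot Filter.atBot :=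
    (Real.tendsto_exp_atTop.comp
      (Filter.tendsto_id.const_mul_atBot_of_neg (by linarith : d < 0))).const_mul_atTop_of_neg
      (neg_lt_zero.2 hδ)
  refine Filter.tendsto_atBot_mono' _ ?_ hlim
  filter_upwards [Filter.eventually_le_atBot s₀] with s hs using hbound s hs
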